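/- arXiv:math/0210123 — 2 statements merged into one kernel-verified Lean document; each statement's English description precedes it below -/
import Mathlib

section
/- Let N be a Hopf algebra over a field k, A a commutative k-algebra, and (M,θ) a universal measuring coalgebra of N to A. Then there exist unique coalgebra maps m: M⊗M → M (with M⊗M the tensor product coalgebra) and η: k → M such that θ(m(f⊗g)⊗n) = ∑ θ(f⊗n_(1)) θ(g⊗n_(2)) and θ(η(1)⊗n) = ε(n)1_A for all f,g ∈ M and n ∈ N; with this multiplication and unit, M is an associative unital algebra and indeed a bialgebra, and the unique coalgebra map S: M^{cop} → M determined by θ(S(f)⊗n) = θ(f⊗S_N(n)) is an antipode, so that M is a Hopf algebra. -/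
open TensorProduct

namespace SmashPaper

variable (k : Type) [Field k]

section Conv

variable {k : Type} [Field k] {C A : Type} [AddCommGroup C] [Module k C] [Coalgebra k C]
  [CommRing A] [Algebra k A]

/-- Convolution product on linear maps from a coalgebra to an algebra. -/
noncomputable def conv (f g : C →ₗ[k] A) : C →ₗ[k] A :=
  LinearMap.mul' k A ∘ₗ TensorProduct.map f g ∘ₗ Coalgebra.comul

/-- Convolution unit. -/
noncomputable def convOne (C A : Type) [AddCommGroup C] [Module k C] [Coalgebra k C]
    [CommRing A] [Algebra k A] : C →ₗ[k] A :=
  Algebra.linearMap k A ∘ₗ Coalgebra.counit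

def IsConvInv (f g : C →ₗ[k] A) : Prop :=
  conv f g = convOne C A ∧ conv g f = convOne C A

def IsConvInvertible (f : C →ₗ[k] A) : Prop := ∃ g, IsConvInv f g

end Conv

/-- Cocommutativity of a coalgebra. -/
def IsCocomm (C : Type) [AddCommGroup C] [Module k C] [Coalgebra k C] : Prop :=
  (TensorProduct.comm k C C).toLinearMap ∘ₗ Coalgebra.comul
    = (Coalgebra.comul : C →ₗ[k] C ⊗[k] C)

section Drop

variable {k : Type} [Field k] (C D : Type) [AddCommGroup C] [Module k C]
  [AddCommGroup D] [Module k D]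

/-- `c ⊗ d ↦ ε(c) d`. -/
noncomputable def dropL [Coalgebra k C] : C ⊗[k] D →ₗ[k] D :=
  (TensorProduct.lid k D).toLinearMap ∘ₗ LinearMap.rTensor D (Coalgebra.counit (R := k))

/-- `c ⊗ d ↦ ε(d) c`. -/
noncomputable def dropR [Coalgebra k D] : C ⊗[k] D →ₗ[k] C :=
  (TensorProduct.rid k C).toLinearMap ∘ₗ LinearMap.lTensor C (Coalgebra.counit (R := k))

end Drop

section Sweedler

variable {k : Type} [Field k] (H A : Type) [Ring H] [Bialgebra k H]
  [CommRing A] [Algebra k A]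

variable {H A}

/-- Normalization for 1-cochains. -/
def Normalized1 (t : H →ₗ[k] A) : Prop := t 1 = 1

/-- Normalization for 2-cochains: trivial whenever an argument is a scalar. -/
def Normalized2 (f : H ⊗[k] H →ₗ[k] A) : Prop :=
  ∀ x : H, f (1 ⊗ₜ[k] x) = algebraMap k A (Coalgebra.counit x)
    ∧ f (x ⊗ₜ[k] 1) = algebraMap k A (Coalgebra.counit x)

/-- Normalization for 3-cochains. -/
def Normalized3 (f : (H ⊗[k] H) ⊗[k] H →ₗ[k] A) : Prop :=
  ∀ x y : H,
    f ((1 ⊗ₜ[k] x) ⊗ₜ[k] y) = algebraMap k A (Coalgebra.counit x * Coalgebra.counit y)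
    ∧ f ((x ⊗ₜ[k] 1) ⊗ₜ[k] y) = algebraMap k A (Coalgebra.counit x * Coalgebra.counit y)
    ∧ f ((x ⊗ₜ[k] y) ⊗ₜ[k] 1) = algebraMap k A (Coalgebra.counit x * Coalgebra.counit y)

/-- `∑ f(x₍₁₎ ⊗ y₍₁₎) f(x₍₂₎y₍₂₎ ⊗ z)` as a linear map on `(H ⊗ H) ⊗ H`. -/
noncomputable def cocycle2LHS (f : H ⊗[k] H →ₗ[k] A) : (H ⊗[k] H) ⊗[k] H →ₗ[k] A :=
  conv (f ∘ₗ dropR (H ⊗[k] H) H) (f ∘ₗ LinearMap.rTensor H (LinearMap.mul' k H))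

/-- `∑ f(y₍₁₎ ⊗ z₍₁₎) f(x ⊗ y₍₂₎z₍₂₎)` as a linear map on `(H ⊗ H) ⊗ H`. -/
noncomputable def cocycle2RHS (f : H ⊗[k] H →ₗ[k] A) : (H ⊗[k] H) ⊗[k] H →ₗ[k] A :=
  conv (f ∘ₗ dropL H (H ⊗[k] H) ∘ₗ (TensorProduct.assoc k H H H).toLinearMap)
       (f ∘ₗ LinearMap.lTensor H (LinearMap.mul' k H) ∘ₗ (TensorProduct.assoc k H H H).toLinearMap)

/-- Sweedler 2-cocycles (for the trivial action). -/
def IsZ2 (f : H ⊗[k] H →ₗ[k] A) : Prop :=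
  Normalized2 f ∧ IsConvInvertible f ∧ cocycle2LHS f = cocycle2RHS f

/-- The Sweedler 2-coboundary `∑ t(y₍₁₎) t⁻¹(x₍₁₎y₍₂₎) t(x₍₂₎)` of a 1-cochain `t`
with convolution inverse `tinv`. -/
noncomputable def cobound2 (t tinv : H →ₗ[k] A) : H ⊗[k] H →ₗ[k] A :=
  conv (t ∘ₗ dropL H H) (conv (tinv ∘ₗ LinearMap.mul' k H) (t ∘ₗ dropR H H))

/-- Sweedler 2-coboundaries (for the trivial action). -/
def IsB2 (f : H ⊗[k] H →ₗ[k] A) : Prop :=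
  ∃ t tinv : H →ₗ[k] A, Normalized1 t ∧ IsConvInv t tinv ∧ f = cobound2 t tinv

/-- Two 2-cochains are cohomologous when they differ (in convolution) by a 2-coboundary. -/
def Cohomologous2 (f f' : H ⊗[k] H →ₗ[k] A) : Prop :=
  ∃ b, IsB2 b ∧ f = conv f' b

/-- `(x⊗y)⊗z ↦ x ⊗ yz`. -/
noncomputable def m23 : (H ⊗[k] H) ⊗[k] H →ₗ[k] H ⊗[k] H :=
  LinearMap.lTensor H (LinearMap.mul' k H) ∘ₗ (TensorProduct.assoc k H H H).toLinearMap

/-- `(x⊗y)⊗z ↦ ε(x) (y⊗z)`. -/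
noncomputable def p23 : (H ⊗[k] H) ⊗[k] H →ₗ[k] H ⊗[k] H :=
  dropL H (H ⊗[k] H) ∘ₗ (TensorProduct.assoc k H H H).toLinearMap

/-- 3-cocycle condition
`∑ f(y₁⊗z₁⊗w₁) f(x₁⊗y₂z₂⊗w₂) f(x₂⊗y₃⊗z₃) = ∑ f(x₁y₁⊗z₁⊗w₁) f(x₂⊗y₂⊗z₂w₂)`. -/
def IsZ3cond (f : (H ⊗[k] H) ⊗[k] H →ₗ[k] A) : Prop :=
  conv (f ∘ₗ LinearMap.rTensor H (LinearMap.rTensor H (dropL H H)))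
    (conv (f ∘ₗ LinearMap.rTensor H (m23 (H := H)))
          (f ∘ₗ dropR ((H ⊗[k] H) ⊗[k] H) H))
  = conv (C := ((H ⊗[k] H) ⊗[k] H) ⊗[k] H)
         (f ∘ₗ LinearMap.rTensor H (LinearMap.rTensor H (LinearMap.mul' k H)))
         (f ∘ₗ (LinearMap.lTensor (H ⊗[k] H) (LinearMap.mul' k H)
              ∘ₗ (TensorProduct.assoc k (H ⊗[k] H) H H).toLinearMap :
                ((H ⊗[k] H) ⊗[k] H) ⊗[k] H →ₗ[k] (H ⊗[k] H) ⊗[k] H))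

/-- Sweedler 3-cocycles (for the trivial action). -/
def IsZ3 (f : (H ⊗[k] H) ⊗[k] H →ₗ[k] A) : Prop :=
  Normalized3 f ∧ IsConvInvertible f ∧ IsZ3cond f

/-- The Sweedler 3-coboundary
`∑ v(y₁⊗z₁) v⁻¹(x₁y₂⊗z₂) v(x₂⊗y₃z₃) v⁻¹(x₃⊗y₄)` of a 2-cochain `v`. -/
noncomputable def cobound3 (v vinv : H ⊗[k] H →ₗ[k] A) : (H ⊗[k] H) ⊗[k] H →ₗ[k] A :=
  conv (v ∘ₗ p23 (H := H))
    (conv (vinv ∘ₗ LinearMap.rTensor H (LinearMap.mul' k H))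
      (conv (v ∘ₗ m23 (H := H)) (vinv ∘ₗ dropR (H ⊗[k] H) H)))

/-- Sweedler 3-coboundaries (for the trivial action). -/
def IsB3 (f : (H ⊗[k] H) ⊗[k] H →ₗ[k] A) : Prop :=
  ∃ v vinv : H ⊗[k] H →ₗ[k] A, Normalized2 v ∧ IsConvInv v vinv ∧ f = cobound3 v vinv

/-- Cohomologous 3-cochains. -/
def Cohomologous3 (f f' : (H ⊗[k] H) ⊗[k] H →ₗ[k] A) : Prop :=
  ∃ b, IsB3 b ∧ f = conv f' b

end Sweedler

section Measuring

variable {k : Type} [Field k]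
variable {C : Type} [AddCommGroup C] [Module k C] [Coalgebra k C]
variable {N : Type} [Ring N] [Bialgebra k N]
variable {A : Type} [CommRing A] [Algebra k A]

/-- `(C, θ)` measures `N` to `A`:
`∑ θ(c₍₁₎ ⊗ n) θ(c₍₂₎ ⊗ n') = θ(c ⊗ nn')` and `θ(c ⊗ 1) = ε(c) 1`. -/
def Measures (θ : C ⊗[k] N →ₗ[k] A) : Prop :=
  (θ ∘ₗ LinearMap.lTensor C (LinearMap.mul' k N)
    = conv (θ ∘ₗ LinearMap.lTensor C (dropR N N)) (θ ∘ₗ LinearMap.lTensor C (dropL N N)))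
  ∧ ∀ c : C, θ (c ⊗ₜ[k] (1 : N)) = algebraMap k A (Coalgebra.counit c)

end Measuring

section Action

variable {k : Type} [Field k]
variable {T N : Type} [Ring T] [Bialgebra k T] [Ring N] [Bialgebra k N]

/-- `μ : T ⊗ N → N` makes `N` a left `T`-module bialgebra. -/
structure IsModuleBialgebra (μ : T ⊗[k] N →ₗ[k] N) : Prop where
  one_act : ∀ n : N, μ ((1 : T) ⊗ₜ[k] n) = n
  mul_act : ∀ (t s : T) (n : N), μ ((t * s) ⊗ₜ[k] n) = μ (t ⊗ₜ[k] μ (s ⊗ₜ[k] n))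
  act_one : ∀ t : T, μ (t ⊗ₜ[k] (1 : N)) = algebraMap k N (Coalgebra.counit t)
  act_mul : μ ∘ₗ LinearMap.lTensor T (LinearMap.mul' k N)
      = LinearMap.mul' k N ∘ₗ TensorProduct.map μ μ
          ∘ₗ (TensorProduct.tensorTensorTensorComm k T T N N).toLinearMap
          ∘ₗ LinearMap.rTensor (N ⊗[k] N) Coalgebra.comul
  comul_act : Coalgebra.comul ∘ₗ μ
      = TensorProduct.map μ μ
          ∘ₗ (TensorProduct.tensorTensorTensorComm k T T N N).toLinearMap
          ∘ₗ TensorProduct.map Coalgebra.comul Coalgebra.comul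
  counit_act : ∀ (t : T) (n : N),
      Coalgebra.counit (R := k) (μ (t ⊗ₜ[k] n))
        = Coalgebra.counit (R := k) t * Coalgebra.counit (R := k) n

/-- `t ⊗ n ↦ ∑ t₍₁₎(n) ⊗ t₍₂₎`. -/
noncomputable def smashCross (μ : T ⊗[k] N →ₗ[k] N) : T ⊗[k] N →ₗ[k] N ⊗[k] T :=
  TensorProduct.map μ LinearMap.id
    ∘ₗ (TensorProduct.assoc k T N T).symm.toLinearMap
    ∘ₗ LinearMap.lTensor T (TensorProduct.comm k T N).toLinearMap
    ∘ₗ (TensorProduct.assoc k T T N).toLinearMap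
    ∘ₗ LinearMap.rTensor N Coalgebra.comul

variable {H : Type} [Ring H] [Bialgebra k H]

/-- `H` is the smash product `N ⋊ T` along the action `μ`, with `N` and `T` included
as the Hopf subalgebras `N ⋊ 1` and `1 ⋊ T`; we identify `n ⋊ t = n t`. -/
structure IsSmashProduct (μ : T ⊗[k] N →ₗ[k] N) (iN : N →ₐc[k] H) (iT : T →ₐc[k] H) : Prop where
  act : IsModuleBialgebra μ
  injN : Function.Injective iN
  injT : Function.Injective iT
  /-- `n ⊗ t ↦ (n ⋊ 1)(1 ⋊ t)` is a linear isomorphism `N ⊗ T ≅ H` (`H` is the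
  tensor product coalgebra `N ⊗ T`). -/
  bij : Function.Bijective
    (LinearMap.mul' k H ∘ₗ TensorProduct.map (iN : N →ₗ[k] H) (iT : T →ₗ[k] H))
  /-- The smash relation `t n = ∑ t₍₁₎(n) t₍₂₎` in `H`. -/
  straighten : LinearMap.mul' k H ∘ₗ TensorProduct.map (iT : T →ₗ[k] H) (iN : N →ₗ[k] H)
      = LinearMap.mul' k H ∘ₗ TensorProduct.map (iN : N →ₗ[k] H) (iT : T →ₗ[k] H)
          ∘ₗ smashCross μ

end Action

section MeasCohomology

variable {k : Type} [Field k]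
variable {T N : Type} [Ring T] [Bialgebra k T] [Ring N] [Bialgebra k N]
variable {A : Type} [CommRing A] [Algebra k A]

/-- Normalization in the `T`-variable for measuring 1-cochains `T ⊗ N → A`. -/
def MeasNormalized1 (f : T ⊗[k] N →ₗ[k] A) : Prop :=
  ∀ n : N, f ((1 : T) ⊗ₜ[k] n) = algebraMap k A (Coalgebra.counit n)

/-- A measuring 1-cochain: an element of `Reg_meas(T, Hom(N,A))`. -/
def IsRegMeas1 (f : T ⊗[k] N →ₗ[k] A) : Prop :=
  Measures f ∧ MeasNormalized1 f ∧ IsConvInvertible f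

/-- The measuring 1-cocycle condition `f(ts)(n) = ∑ f(s₍₁₎)(n₍₁₎) f(t)(s₍₂₎(n₍₂₎))`. -/
def MeasCocycle1 (μ : T ⊗[k] N →ₗ[k] N) (f : T ⊗[k] N →ₗ[k] A) : Prop :=
  f ∘ₗ LinearMap.rTensor N (LinearMap.mul' k T)
    = conv (f ∘ₗ LinearMap.rTensor N (dropL T T))
      (f ∘ₗ LinearMap.lTensor T μ ∘ₗ (TensorProduct.assoc k T T N).toLinearMap)

/-- Measuring 1-cocycles. -/
def IsMeasZ1 (μ : T ⊗[k] N →ₗ[k] N) (f : T ⊗[k] N →ₗ[k] A) : Prop :=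
  IsRegMeas1 f ∧ MeasCocycle1 μ f

/-- Measuring 1-coboundaries: `f(t)(n) = ∑ g(n₍₁₎) g⁻¹(t(n₍₂₎))` for a
convolution-invertible algebra map `g : N → A`. -/
def IsMeasB1 (μ : T ⊗[k] N →ₗ[k] N) (f : T ⊗[k] N →ₗ[k] A) : Prop :=
  ∃ (g : N →ₐ[k] A) (ginv : N →ₗ[k] A), IsConvInv g.toLinearMap ginv ∧
    f = conv (g.toLinearMap ∘ₗ dropL T N) (ginv ∘ₗ μ)

/-- Normalization for measuring 2-cochains `(T ⊗ T) ⊗ N → A`. -/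
def MeasNormalized2 (f : (T ⊗[k] T) ⊗[k] N →ₗ[k] A) : Prop :=
  ∀ (t : T) (n : N),
    f (((1 : T) ⊗ₜ[k] t) ⊗ₜ[k] n)
        = algebraMap k A (Coalgebra.counit t * Coalgebra.counit n)
    ∧ f ((t ⊗ₜ[k] (1 : T)) ⊗ₜ[k] n)
        = algebraMap k A (Coalgebra.counit t * Coalgebra.counit n)

/-- A measuring 2-cochain: an element of `Reg_meas(T ⊗ T, Hom(N,A))`. -/
def IsRegMeas2 (f : (T ⊗[k] T) ⊗[k] N →ₗ[k] A) : Prop :=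
  Measures f ∧ MeasNormalized2 f ∧ IsConvInvertible f

/-- The measuring 2-cocycle condition
`∑ f(t₍₁₎⊗s₍₁₎)(r₍₁₎(n₍₁₎)) f(t₍₂₎s₍₂₎⊗r₍₂₎)(n₍₂₎) = ∑ f(s₍₁₎⊗r₍₁₎)(n₍₁₎) f(t⊗s₍₂₎r₍₂₎)(n₍₂₎)`. -/
def MeasCocycle2 (μ : T ⊗[k] N →ₗ[k] N) (f : (T ⊗[k] T) ⊗[k] N →ₗ[k] A) : Prop :=
  conv (C := ((T ⊗[k] T) ⊗[k] T) ⊗[k] N)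
       (f ∘ₗ (LinearMap.lTensor (T ⊗[k] T) μ
          ∘ₗ (TensorProduct.assoc k (T ⊗[k] T) T N).toLinearMap :
            ((T ⊗[k] T) ⊗[k] T) ⊗[k] N →ₗ[k] (T ⊗[k] T) ⊗[k] N))
       (f ∘ₗ LinearMap.rTensor N (LinearMap.rTensor T (LinearMap.mul' k T)))
    = conv (C := ((T ⊗[k] T) ⊗[k] T) ⊗[k] N)
           (f ∘ₗ LinearMap.rTensor N (LinearMap.rTensor T (dropL T T)))
           (f ∘ₗ LinearMap.rTensor N
              ((LinearMap.lTensor T (LinearMap.mul' k T)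
                ∘ₗ (TensorProduct.assoc k T T T).toLinearMap :
                  (T ⊗[k] T) ⊗[k] T →ₗ[k] T ⊗[k] T)))

/-- Measuring 2-cocycles. -/
def IsMeasZ2 (μ : T ⊗[k] N →ₗ[k] N) (f : (T ⊗[k] T) ⊗[k] N →ₗ[k] A) : Prop :=
  IsRegMeas2 f ∧ MeasCocycle2 μ f

/-- The measuring coboundary
`(t ⊗ s ⊗ n) ↦ ∑ g(s₍₁₎)(n₍₁₎) g⁻¹(t₍₁₎s₍₂₎)(n₍₂₎) g(t₍₂₎)(s₍₃₎(n₍₃₎))`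
of a 1-cochain `g` with convolution inverse `ginv`.  (For a 2-cocycle `f` on `N` with
stability witness `g`, this same formula is the map `d`. ) -/
noncomputable def measCobound (μ : T ⊗[k] N →ₗ[k] N) (g ginv : T ⊗[k] N →ₗ[k] A) :
    (T ⊗[k] T) ⊗[k] N →ₗ[k] A :=
  conv (g ∘ₗ LinearMap.rTensor N (dropL T T))
    (conv (ginv ∘ₗ LinearMap.rTensor N (LinearMap.mul' k T))
          (g ∘ₗ LinearMap.lTensor T μ ∘ₗ (TensorProduct.assoc k T T N).toLinearMap))

/-- Measuring 2-coboundaries. -/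
def IsMeasB2 (μ : T ⊗[k] N →ₗ[k] N) (f : (T ⊗[k] T) ⊗[k] N →ₗ[k] A) : Prop :=
  ∃ g ginv : T ⊗[k] N →ₗ[k] A, IsRegMeas1 g ∧ IsConvInv g ginv ∧ f = measCobound μ g ginv

/-- Cohomologous measuring 2-cochains. -/
def MeasCohomologous2 (μ : T ⊗[k] N →ₗ[k] N) (f f' : (T ⊗[k] T) ⊗[k] N →ₗ[k] A) : Prop :=
  ∃ b, IsMeasB2 μ b ∧ f = conv f' b

/-- `∑ f(n₍₁₎ ⊗ n'₍₁₎) f⁻¹(t₍₁₎(n₍₂₎) ⊗ t₍₂₎(n'₍₂₎))` as a map `T ⊗ (N ⊗ N) → A`. -/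
noncomputable def stabLHS (μ : T ⊗[k] N →ₗ[k] N) (f finv : N ⊗[k] N →ₗ[k] A) :
    T ⊗[k] (N ⊗[k] N) →ₗ[k] A :=
  conv (f ∘ₗ dropL T (N ⊗[k] N))
       (finv ∘ₗ TensorProduct.map μ μ
          ∘ₗ (TensorProduct.tensorTensorTensorComm k T T N N).toLinearMap
          ∘ₗ LinearMap.rTensor (N ⊗[k] N) Coalgebra.comul)

/-- `∑ g(t₍₁₎ ⊗ n₍₁₎) g⁻¹(t₍₂₎ ⊗ n₍₂₎n'₍₁₎) g(t₍₃₎ ⊗ n'₍₂₎)` as a map `T ⊗ (N ⊗ N) → A`. -/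
noncomputable def stabRHS (g ginv : T ⊗[k] N →ₗ[k] A) : T ⊗[k] (N ⊗[k] N) →ₗ[k] A :=
  conv (g ∘ₗ LinearMap.lTensor T (dropR N N))
    (conv (ginv ∘ₗ LinearMap.lTensor T (LinearMap.mul' k N))
          (g ∘ₗ LinearMap.lTensor T (dropL N N)))

/-- `g` (with convolution inverse `ginv`) witnesses the `T`-stability of the
2-cochain `f` on `N` (with convolution inverse `finv`):
`f * (f⁻¹)ᵗ = δ'(g(t ⊗ _))`. -/
def IsStabilityWitness (μ : T ⊗[k] N →ₗ[k] N) (f finv : N ⊗[k] N →ₗ[k] A)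
    (g ginv : T ⊗[k] N →ₗ[k] A) : Prop :=
  MeasNormalized1 g ∧ (∀ t : T, g (t ⊗ₜ[k] (1 : N)) = algebraMap k A (Coalgebra.counit t))
    ∧ IsConvInv g ginv ∧ stabLHS μ f finv = stabRHS g ginv

/-- The cohomology class of the 2-cocycle `f` on `N` is `T`-stable. -/
def IsTStable (μ : T ⊗[k] N →ₗ[k] N) (f finv : N ⊗[k] N →ₗ[k] A) : Prop :=
  ∃ g ginv, IsStabilityWitness μ f finv g ginv

end MeasCohomology

section SmashStatements

variable {k : Type} [Field k]
variable {T N H A : Type} [Ring T] [Bialgebra k T] [Ring N] [Bialgebra k N]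
  [Ring H] [Bialgebra k H] [CommRing A] [Algebra k A]

/-- `n ⊗ t ↦ (n ⋊ 1)(1 ⋊ t) = n ⋊ t`. -/
noncomputable def smashMul (iN : N →ₐc[k] H) (iT : T →ₐc[k] H) : N ⊗[k] T →ₗ[k] H :=
  LinearMap.mul' k H ∘ₗ TensorProduct.map iN.toLinearMap iT.toLinearMap

/-- The restriction of a 2-cochain on `H` to `N ⊗ N`. -/
noncomputable def resNN (iN : N →ₐc[k] H) (f : H ⊗[k] H →ₗ[k] A) : N ⊗[k] N →ₗ[k] A :=
  f ∘ₗ TensorProduct.map iN.toLinearMap iN.toLinearMap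

/-- The restriction of a 2-cochain on `H` to `T ⊗ T`. -/
noncomputable def resTT (iT : T →ₐc[k] H) (f : H ⊗[k] H →ₗ[k] A) : T ⊗[k] T →ₗ[k] A :=
  f ∘ₗ TensorProduct.map iT.toLinearMap iT.toLinearMap

/-- The restriction of a 2-cochain on `H` to `T ⊗ N`. -/
noncomputable def resTN (iN : N →ₐc[k] H) (iT : T →ₐc[k] H) (f : H ⊗[k] H →ₗ[k] A) :
    T ⊗[k] N →ₗ[k] A :=
  f ∘ₗ TensorProduct.map iT.toLinearMap iN.toLinearMap

/-- `f` is trivial on `N ⊗ T`: `f(n ⊗ t) = ε(n)ε(t)1`. -/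
def TrivialOnNT (iN : N →ₐc[k] H) (iT : T →ₐc[k] H) (f : H ⊗[k] H →ₗ[k] A) : Prop :=
  ∀ (n : N) (t : T), f (iN n ⊗ₜ[k] iT t)
    = algebraMap k A (Coalgebra.counit n * Coalgebra.counit t)

/-- `f` is trivial on `T ⊗ T`. -/
def TrivialOnTT (iT : T →ₐc[k] H) (f : H ⊗[k] H →ₗ[k] A) : Prop :=
  ∀ t t' : T, f (iT t ⊗ₜ[k] iT t')
    = algebraMap k A (Coalgebra.counit t * Coalgebra.counit t')

/-- `F` is the 2-cochain `ι f : (n ⋊ t) ⊗ (n' ⋊ t') ↦ ε(n) f(t)(n') ε(t')` on `H`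
associated with a measuring 1-cochain `f`. -/
def IotaOf (iN : N →ₐc[k] H) (iT : T →ₐc[k] H) (f : T ⊗[k] N →ₗ[k] A)
    (F : H ⊗[k] H →ₗ[k] A) : Prop :=
  ∀ (n : N) (t : T) (n' : N) (t' : T),
    F ((iN n * iT t) ⊗ₜ[k] (iN n' * iT t'))
      = algebraMap k A (Coalgebra.counit n * Coalgebra.counit t') * f (t ⊗ₜ[k] n')

/-- `J` is the 3-cochain
`jf : (n⋊t) ⊗ (n'⋊t') ⊗ (n''⋊t'') ↦ ε(n)ε(n') f(t⊗t')(n'') ε(t'')` on `H`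
associated with a measuring 2-cochain `f`. -/
def JOf (iN : N →ₐc[k] H) (iT : T →ₐc[k] H) (f : (T ⊗[k] T) ⊗[k] N →ₗ[k] A)
    (J : (H ⊗[k] H) ⊗[k] H →ₗ[k] A) : Prop :=
  ∀ (n : N) (t : T) (n' : N) (t' : T) (n'' : N) (t'' : T),
    J (((iN n * iT t) ⊗ₜ[k] (iN n' * iT t')) ⊗ₜ[k] (iN n'' * iT t''))
      = algebraMap k A (Coalgebra.counit n * Coalgebra.counit n' * Coalgebra.counit t'')
          * f ((t ⊗ₜ[k] t') ⊗ₜ[k] n'')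

end SmashStatements

end SmashPaper

open TensorProduct SmashPaper


section UniversalMeasuring

variable {k : Type} [Field k]
variable {N A : Type} [Ring N] [Bialgebra k N] [CommRing A] [Algebra k A]

/-- `(M, θ)` is a universal measuring coalgebra of `N` to `A`: it measures `N` to `A`,
and every measuring `(C, f)` factors through it by a unique coalgebra map. -/
structure IsUniversalMeasuring (M : Type) [AddCommGroup M] [Module k M] [Coalgebra k M]
    (θ : M ⊗[k] N →ₗ[k] A) : Prop where
  meas : Measures θ
  univ : ∀ (C : Type) [AddCommGroup C] [Module k C] [Coalgebra k C],
    ∀ f : C ⊗[k] N →ₗ[k] A, Measures f →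
      ∃! φ : C →ₗc[k] M, f = θ ∘ₗ LinearMap.rTensor N φ.toLinearMap

variable {M : Type} [AddCommGroup M] [Module k M] [Coalgebra k M]

/-- The measuring `ω : (M ⊗ M) ⊗ N → A`, `ω(f ⊗ g ⊗ n) = ∑ θ(f ⊗ n₍₁₎) θ(g ⊗ n₍₂₎)`. -/
noncomputable def mulMeasuring (θ : M ⊗[k] N →ₗ[k] A) : (M ⊗[k] M) ⊗[k] N →ₗ[k] A :=
  LinearMap.mul' k A ∘ₗ TensorProduct.map θ θ
    ∘ₗ (TensorProduct.tensorTensorTensorComm k M M N N).toLinearMap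
    ∘ₗ LinearMap.lTensor (M ⊗[k] M) Coalgebra.comul

/-- Convolution of two maps with values in `M`, with respect to a multiplication
map `m` on `M`. -/
noncomputable def mconv {C : Type} [AddCommGroup C] [Module k C] [Coalgebra k C]
    (m : M ⊗[k] M →ₗ[k] M) (f g : C →ₗ[k] M) : C →ₗ[k] M :=
  m ∘ₗ TensorProduct.map f g ∘ₗ Coalgebra.comul

end UniversalMeasuring

open Coalgebra

section MeasuringLemmas

variable {k : Type} [Field k]
variable {C D : Type} [AddCommGroup C] [Module k C] [Coalgebra k C]
  [AddCommGroup D] [Module k D] [Coalgebra k D]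
variable {N : Type} [Ring N] [Bialgebra k N] {A : Type} [CommRing A] [Algebra k A]

lemma conv_apply_repr {ι : Type*} {c : C} (r : Repr k c ι) (f g : C →ₗ[k] A) :
    conv f g c = ∑ i ∈ r.index, f (r.left i) * g (r.right i) := by
  simp [conv, ← r.eq]

/-- The map `c ↦ θ(c ⊗ n)`. -/
noncomputable def evalRight {E : Type} [AddCommGroup E] [Module k E]
    (θ : E ⊗[k] N →ₗ[k] A) (n : N) : E →ₗ[k] A :=
  θ ∘ₗ (TensorProduct.mk k E N).flip n

@[simp] lemma evalRight_apply {E : Type} [AddCommGroup E] [Module k E]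
    (θ : E ⊗[k] N →ₗ[k] A) (n : N) (x : E) : evalRight θ n x = θ (x ⊗ₜ[k] n) := rfl

lemma conv_dropR_dropL_tmul (θ : C ⊗[k] N →ₗ[k] A) (c : C) (n n' : N) :
    conv (θ ∘ₗ LinearMap.lTensor C (dropR N N)) (θ ∘ₗ LinearMap.lTensor C (dropL N N))
        (c ⊗ₜ[k] (n ⊗ₜ[k] n'))
      = conv (evalRight θ n) (evalRight θ n') c := by
  have h : ∀ x y : C, ∑ i ∈ (ℛ k n).index, ∑ j ∈ (ℛ k n').index,
      θ (x ⊗ₜ[k] (counit (R := k) ((ℛ k n').left j) • (ℛ k n).left i))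
        * θ (y ⊗ₜ[k] (counit (R := k) ((ℛ k n).right i) • (ℛ k n').right j))
      = θ (x ⊗ₜ[k] n) * θ (y ⊗ₜ[k] n') := by
    intro x y
    have h1 : ∑ i ∈ (ℛ k n).index, counit (R := k) ((ℛ k n).right i) • (ℛ k n).left i = n := by
      simpa only [map_sum, rid_tmul, one_smul] using
        congrArg (TensorProduct.rid k N) (sum_tmul_counit_eq (ℛ k n))
    have h2 := sum_counit_smul (ℛ k n')
    conv_rhs => rw [← h1, ← h2]
    simp only [tmul_sum, map_sum, tmul_smul, map_smul, Finset.sum_mul_sum, smul_mul_assoc,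
      mul_smul_comm]
    refine Finset.sum_congr rfl fun i _ => Finset.sum_congr rfl fun j _ => ?_
    rw [smul_comm]
  simp only [conv_apply_repr (ℛ k c), evalRight_apply, ← h]
  simp only [conv, LinearMap.comp_apply, TensorProduct.comul_tmul]
  rw [← (ℛ k c).eq, ← (ℛ k n).eq, ← (ℛ k n').eq]
  simp only [sum_tmul, tmul_sum, map_sum]
  refine Finset.sum_comm.trans ?_
  simp only [dropL, dropR, AlgebraTensorModule.tensorTensorTensorComm_tmul, map_tmul,
    LinearMap.comp_apply, LinearMap.lTensor_tmul, LinearMap.rTensor_tmul, LinearEquiv.coe_coe,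
    rid_tmul, lid_tmul, LinearMap.mul'_apply]
  exact (Finset.sum_comm.trans (Finset.sum_congr rfl fun _ _ => Finset.sum_comm)).symm

/-- A linear map is a measuring iff `n ↦ θ(- ⊗ n)` is multiplicative and unital for the
convolution product. -/
lemma measures_iff {θ : C ⊗[k] N →ₗ[k] A} :
    Measures θ ↔ (∀ n n' : N, evalRight θ (n * n') = conv (evalRight θ n) (evalRight θ n'))
      ∧ ∀ c : C, θ (c ⊗ₜ[k] (1 : N)) = algebraMap k A (counit c) := by
  refine and_congr_left fun _ => ⟨fun h n n' => ?_, fun h => ?_⟩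
  · ext c
    rw [← conv_dropR_dropL_tmul, ← h]
    simp
  · ext c n n'
    simpa [conv_dropR_dropL_tmul] using LinearMap.congr_fun (h n n') c

lemma SmashPaper.Measures.apply_mul {ι : Type*} {θ : C ⊗[k] N →ₗ[k] A} (h : Measures θ) {c : C}
    (r : Repr k c ι) (n n' : N) :
    θ (c ⊗ₜ[k] (n * n')) = ∑ i ∈ r.index, θ (r.left i ⊗ₜ[k] n) * θ (r.right i ⊗ₜ[k] n') := by
  simpa [conv_apply_repr r] using LinearMap.congr_fun ((measures_iff.1 h).1 n n') c

lemma SmashPaper.Measures.comp {θ : C ⊗[k] N →ₗ[k] A} (h : Measures θ) (φ : D →ₗc[k] C) :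
    Measures (θ ∘ₗ LinearMap.rTensor N φ.toLinearMap) := by
  refine measures_iff.2 ⟨fun n n' => ?_, fun d => ?_⟩
  · ext d
    simpa [conv_apply_repr (ℛ k d)] using h.apply_mul ((ℛ k d).induced φ) n n'
  · simpa using h.2 (φ d)

lemma conv_tmul (f g : C ⊗[k] D →ₗ[k] A) (c : C) (d : D) :
    conv f g (c ⊗ₜ[k] d) = ∑ i ∈ (ℛ k c).index, ∑ j ∈ (ℛ k d).index,
      f ((ℛ k c).left i ⊗ₜ[k] (ℛ k d).left j) * g ((ℛ k c).right i ⊗ₜ[k] (ℛ k d).right j) := by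
  rw [conv, LinearMap.comp_apply, LinearMap.comp_apply, TensorProduct.comul_tmul,
    ← (ℛ k c).eq, ← (ℛ k d).eq]
  simp only [sum_tmul, tmul_sum, map_sum]
  refine Finset.sum_comm.trans ?_
  simp

lemma mulMeasuring_tmul {E : Type} [AddCommGroup E] [Module k E]
    (θ : E ⊗[k] N →ₗ[k] A) (x y : E) (n : N) :
    mulMeasuring θ ((x ⊗ₜ[k] y) ⊗ₜ[k] n)
      = LinearMap.mul' k A (TensorProduct.map (θ ∘ₗ TensorProduct.mk k E N x)
          (θ ∘ₗ TensorProduct.mk k E N y) (comul n)) := by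
  simp only [mulMeasuring, LinearMap.comp_apply, LinearMap.lTensor_tmul, ← (ℛ k n).eq]
  simp [tmul_sum]

lemma mulMeasuring_repr {E : Type} [AddCommGroup E] [Module k E] {ι : Type*}
    (θ : E ⊗[k] N →ₗ[k] A) (x y : E) {n : N} (r : Repr k n ι) :
    mulMeasuring θ ((x ⊗ₜ[k] y) ⊗ₜ[k] n)
      = ∑ i ∈ r.index, θ (x ⊗ₜ[k] r.left i) * θ (y ⊗ₜ[k] r.right i) := by
  simp [mulMeasuring_tmul, ← r.eq]

lemma SmashPaper.Measures.map_mul_tensor {θ : C ⊗[k] N →ₗ[k] A} (h : Measures θ) (x y : C)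
    (X Y : N ⊗[k] N) :
    LinearMap.mul' k A (TensorProduct.map (θ ∘ₗ TensorProduct.mk k C N x)
        (θ ∘ₗ TensorProduct.mk k C N y) (X * Y))
      = ∑ i ∈ (ℛ k x).index, ∑ j ∈ (ℛ k y).index,
        LinearMap.mul' k A (TensorProduct.map (θ ∘ₗ TensorProduct.mk k C N ((ℛ k x).left i))
            (θ ∘ₗ TensorProduct.mk k C N ((ℛ k y).left j)) X)
          * LinearMap.mul' k A (TensorProduct.map (θ ∘ₗ TensorProduct.mk k C N ((ℛ k x).right i))
            (θ ∘ₗ TensorProduct.mk k C N ((ℛ k y).right j)) Y) := by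
  induction X with
  | zero => simp
  | add X X' hX hX' => simp only [add_mul, map_add, hX, hX', Finset.sum_add_distrib]
  | tmul a b =>
    induction Y with
    | zero => simp
    | add Y Y' hY hY' => simp only [mul_add, map_add, hY, hY', Finset.sum_add_distrib]
    | tmul a' b' =>
      simp only [Algebra.TensorProduct.tmul_mul_tmul, map_tmul, LinearMap.comp_apply, mk_apply,
        LinearMap.mul'_apply, h.apply_mul (ℛ k x), h.apply_mul (ℛ k y), Finset.sum_mul_sum]
      exact Finset.sum_congr rfl fun _ _ => Finset.sum_congr rfl fun _ _ => mul_mul_mul_comm ..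

lemma SmashPaper.Measures.mulMeasuring {θ : C ⊗[k] N →ₗ[k] A} (h : Measures θ) :
    Measures (mulMeasuring θ) := by
  refine measures_iff.2 ⟨fun n n' => ?_, fun c => ?_⟩
  · ext x y
    simp [conv_tmul, mulMeasuring_tmul, h.map_mul_tensor]
  · induction c with
    | zero => simp
    | add c d hc hd => simp [add_tmul, hc, hd]
    | tmul x y => simp [mulMeasuring_tmul, Algebra.TensorProduct.one_def, h.2, mul_comm]

lemma measures_counit : Measures (Algebra.linearMap k A ∘ₗ dropL k k ∘ₗ
    LinearMap.lTensor k (counit (R := k) (A := N))) := by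
  refine measures_iff.2 ⟨fun n n' => ?_, fun c => ?_⟩
  · ext
    simp [conv, dropL, CommSemiring.comul_apply]
  · simp [dropL]

/-- The coopposite of a coalgebra. -/
def Coop (C : Type) : Type := C

namespace Coop

instance : AddCommGroup (Coop C) := inferInstanceAs (AddCommGroup C)

instance : Module k (Coop C) := inferInstanceAs (Module k C)

variable (k C) in
/-- The identity, as a linear equivalence from a coalgebra to its coopposite. -/
def equiv : C ≃ₗ[k] Coop C := LinearEquiv.refl k C

noncomputable instance : CoalgebraStruct k (Coop C) where
  comul := TensorProduct.map (equiv k C).toLinearMap (equiv k C).toLinearMap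
    ∘ₗ (TensorProduct.comm k C C).toLinearMap ∘ₗ comul ∘ₗ (equiv k C).symm.toLinearMap
  counit := counit ∘ₗ (equiv k C).symm.toLinearMap

lemma comul_equiv (c : C) : comul (R := k) (equiv k C c)
    = TensorProduct.map (equiv k C).toLinearMap (equiv k C).toLinearMap
      (TensorProduct.comm k C C (comul c)) := rfl

lemma counit_equiv (c : C) : counit (R := k) (equiv k C c) = counit (R := k) c := rfl

/-- An expansion of a comultiplication gives one in the coopposite, with the factors swapped. -/
@[simps]
def repr {ι : Type*} {c : C} (r : Repr k c ι) : Repr k (equiv k C c) ι where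
  index := r.index
  left i := equiv k C (r.right i)
  right i := equiv k C (r.left i)
  eq := by simp [comul_equiv, ← r.eq]

noncomputable instance : Coalgebra k (Coop C) where
  coassoc := by
    ext c'
    obtain ⟨c, rfl⟩ := (equiv k C).surjective c'
    have h := sum_tmul_tmul_eq (ℛ k c) (fun i => ℛ k _) (fun i => ℛ k _)
    have h' := congrArg (TensorProduct.map (equiv k C).toLinearMap
      (TensorProduct.map (equiv k C).toLinearMap (equiv k C).toLinearMap) ∘
        TensorProduct.assoc k C C C ∘ (TensorProduct.comm k C (C ⊗[k] C)) ∘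
        TensorProduct.map LinearMap.id (TensorProduct.comm k C C).toLinearMap) h
    simp only [Function.comp_apply, map_sum, map_tmul, comm_tmul, assoc_tmul, LinearMap.id_coe, id,
      LinearEquiv.coe_coe] at h'
    simp only [LinearMap.comp_apply, LinearEquiv.coe_coe, ← (repr (ℛ k c)).eq, map_sum,
      LinearMap.rTensor_tmul, LinearMap.lTensor_tmul, repr_left, repr_right, repr_index]
    simp only [← (repr (ℛ k ((ℛ k c).left _))).eq, ← (repr (ℛ k ((ℛ k c).right _))).eq]
    simp only [sum_tmul, tmul_sum, map_sum, repr_left, repr_right, repr_index, assoc_tmul]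
    exact h'.symm
  rTensor_counit_comp_comul := by
    ext c'
    obtain ⟨c, rfl⟩ := (equiv k C).surjective c'
    have h := congrArg (TensorProduct.map LinearMap.id (equiv k C).toLinearMap ∘
      TensorProduct.comm k C k) (sum_tmul_counit_eq (ℛ k c))
    simp only [Function.comp_apply, map_sum, comm_tmul, map_tmul, LinearMap.id_coe, id,
      LinearEquiv.coe_coe] at h
    simpa only [LinearMap.comp_apply, ← (repr (ℛ k c)).eq, map_sum, LinearMap.rTensor_tmul,
      LinearMap.lTensor_tmul, counit_equiv, repr_left, repr_right, repr_index, mk_apply,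
      LinearMap.flip_apply] using h
  lTensor_counit_comp_comul := by
    ext c'
    obtain ⟨c, rfl⟩ := (equiv k C).surjective c'
    have h := congrArg (TensorProduct.map (equiv k C).toLinearMap LinearMap.id ∘
      TensorProduct.comm k k C) (sum_counit_tmul_eq (ℛ k c))
    simp only [Function.comp_apply, map_sum, comm_tmul, map_tmul, LinearMap.id_coe, id,
      LinearEquiv.coe_coe] at h
    simpa only [LinearMap.comp_apply, ← (repr (ℛ k c)).eq, map_sum, LinearMap.rTensor_tmul,
      LinearMap.lTensor_tmul, counit_equiv, repr_left, repr_right, repr_index, mk_apply,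
      LinearMap.flip_apply] using h

end Coop

end MeasuringLemmas

section AntipodeMeasuring

variable {k : Type} [Field k] {C : Type} [AddCommGroup C] [Module k C] [Coalgebra k C]
  {N : Type} [Ring N] [HopfAlgebra k N] {A : Type} [CommRing A] [Algebra k A]

lemma SmashPaper.Measures.comp_antipode {θ : C ⊗[k] N →ₗ[k] A} (h : Measures θ) :
    Measures (θ ∘ₗ TensorProduct.map (Coop.equiv k C).symm.toLinearMap
      (HopfAlgebra.antipode k)) := by
  refine measures_iff.2 ⟨fun n n' => ?_, fun c' => ?_⟩
  · ext c'
    obtain ⟨c, rfl⟩ := (Coop.equiv k C).surjective c'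
    simp [conv_apply_repr (Coop.repr (ℛ k c)), HopfAlgebra.antipode_mul_antidistrib,
      h.apply_mul (ℛ k c), mul_comm]
  · obtain ⟨c, rfl⟩ := (Coop.equiv k C).surjective c'
    simp [h.2, Coop.counit_equiv]

end AntipodeMeasuring

section Antipode

open WithConv
open Algebra.TensorProduct (includeLeft includeRight)

variable {k : Type} [Field k] {H : Type} [Ring H] [Bialgebra k H]

lemma toConv_comul_eq_includeLeft_mul_includeRight :
    toConv (comul (R := k) (A := H))
      = toConv (includeLeft : H →ₐ[k] H ⊗[k] H).toLinearMap
        * toConv (includeRight : H →ₐ[k] H ⊗[k] H).toLinearMap := by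
  ext x
  simp [(ℛ k x).convMul_apply, (ℛ k x).eq]

lemma toConv_comul_comp_eq_includeRight_mul_includeLeft {S : H →ₗ[k] H}
    (hS : comul ∘ₗ S = TensorProduct.map S S ∘ₗ (TensorProduct.comm k H H).toLinearMap
      ∘ₗ comul) :
    toConv (comul (R := k) ∘ₗ S)
      = toConv ((includeRight : H →ₐ[k] H ⊗[k] H).toLinearMap ∘ₗ S)
        * toConv ((includeLeft : H →ₐ[k] H ⊗[k] H).toLinearMap ∘ₗ S) := by
  ext x
  rw [(ℛ k x).convMul_apply, hS]
  simp [← (ℛ k x).eq]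

lemma toConv_algHom_comp_sub_one {B : Type} [Ring B] [Algebra k B] (h : H →ₐ[k] B)
    (f : WithConv (H →ₗ[k] H)) :
    toConv (h.toLinearMap ∘ₗ (f - 1).ofConv) = toConv (h.toLinearMap ∘ₗ f.ofConv) - 1 := by
  ext x
  simp

/-- If `S` is an anti-coalgebra endomorphism of a bialgebra, then the range of
`h ↦ ∑ S(h₍₁₎) h₍₂₎ - ε(h) 1` is a coideal. -/
lemma isCoideal_range_mul_id_sub_one {S : H →ₗ[k] H}
    (hcomul : comul ∘ₗ S = TensorProduct.map S S ∘ₗ (TensorProduct.comm k H H).toLinearMap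
      ∘ₗ comul) (hcounit : counit ∘ₗ S = counit (R := k)) :
    (LinearMap.range (toConv S * toConv LinearMap.id - 1).ofConv).IsCoideal := by
  set d := toConv S * toConv LinearMap.id - 1 with hd
  set I := LinearMap.range d.ofConv
  have hmem : ∀ x, I.mkQ (d x) = 0 := fun x =>
    (Submodule.Quotient.mk_eq_zero _).2 ⟨x, rfl⟩
  constructor
  · rintro _ ⟨x, rfl⟩
    have h : counit (R := k) ((toConv S * toConv LinearMap.id : WithConv (H →ₗ[k] H)) x) = counit (R := k) x := by
      have hS (y : H) : counit (R := k) (S y) = counit (R := k) y := LinearMap.congr_fun hcounit y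
      rw [(ℛ k x).convMul_apply]
      simpa [hS] using congrArg (counit (R := k)) (sum_counit_smul (ℛ k x))
    simp only [hd, ofConv_sub, LinearMap.sub_apply, map_sub, h, LinearMap.convOne_apply,
      Bialgebra.counit_algebraMap, sub_self]
  · rintro _ ⟨x, rfl⟩
    have key : toConv (comul (R := k) ∘ₗ d.ofConv)
        = toConv ((includeRight : H →ₐ[k] H ⊗[k] H).toLinearMap ∘ₗ S)
            * toConv ((includeLeft : H →ₐ[k] H ⊗[k] H).toLinearMap ∘ₗ d.ofConv)
            * toConv (includeRight : H →ₐ[k] H ⊗[k] H).toLinearMap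
          + toConv ((includeRight : H →ₐ[k] H ⊗[k] H).toLinearMap ∘ₗ d.ofConv) := by
      have hc : toConv (comul (R := k) ∘ₗ d.ofConv) = toConv (comul ∘ₗ S) * toConv comul - 1 := by
        rw [← Bialgebra.toLinearMap_comulAlgHom, hd, toConv_algHom_comp_sub_one,
          LinearMap.algHom_comp_convMul_distrib]
        simp only [toConv_ofConv, LinearMap.comp_id]
      rw [hc, toConv_comul_comp_eq_includeRight_mul_includeLeft hcomul,
        toConv_comul_eq_includeLeft_mul_includeRight, hd]
      simp only [toConv_algHom_comp_sub_one, LinearMap.algHom_comp_convMul_distrib,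
        toConv_ofConv, LinearMap.comp_id]
      simp only [sub_mul, mul_sub, mul_one, mul_assoc]
      abel
    have h := congrArg (TensorProduct.map I.mkQ I.mkQ) (LinearMap.congr_fun (congrArg ofConv key) x)
    refine h.trans ?_
    rw [ofConv_add, LinearMap.add_apply, map_add, (ℛ k x).convMul_apply]
    simp only [(ℛ k ((ℛ k x).left _)).convMul_apply]
    simp [hmem, Finset.sum_mul]

/-- If `S` is an anti-coalgebra endomorphism of a bialgebra, then the range of
`h ↦ ∑ h₍₁₎ S(h₍₂₎) - ε(h) 1` is a coideal. -/
lemma isCoideal_range_id_mul_sub_one {S : H →ₗ[k] H}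
    (hcomul : comul ∘ₗ S = TensorProduct.map S S ∘ₗ (TensorProduct.comm k H H).toLinearMap
      ∘ₗ comul) (hcounit : counit ∘ₗ S = counit (R := k)) :
    (LinearMap.range (toConv LinearMap.id * toConv S - 1).ofConv).IsCoideal := by
  set d := toConv LinearMap.id * toConv S - 1 with hd
  set I := LinearMap.range d.ofConv
  have hmem : ∀ x, I.mkQ (d x) = 0 := fun x =>
    (Submodule.Quotient.mk_eq_zero _).2 ⟨x, rfl⟩
  constructor
  · rintro _ ⟨x, rfl⟩
    have h : counit (R := k) ((toConv LinearMap.id * toConv S : WithConv (H →ₗ[k] H)) x) = counit (R := k) x := by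
      have hS (y : H) : counit (R := k) (S y) = counit (R := k) y := LinearMap.congr_fun hcounit y
      rw [(ℛ k x).convMul_apply]
      simpa [hS] using congrArg (counit (R := k)) (sum_counit_smul (ℛ k x))
    simp only [hd, ofConv_sub, LinearMap.sub_apply, map_sub, h, LinearMap.convOne_apply,
      Bialgebra.counit_algebraMap, sub_self]
  · rintro _ ⟨x, rfl⟩
    have key : toConv (comul (R := k) ∘ₗ d.ofConv)
        = toConv (includeLeft : H →ₐ[k] H ⊗[k] H).toLinearMap
            * toConv ((includeRight : H →ₐ[k] H ⊗[k] H).toLinearMap ∘ₗ d.ofConv)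
            * toConv ((includeLeft : H →ₐ[k] H ⊗[k] H).toLinearMap ∘ₗ S)
          + toConv ((includeLeft : H →ₐ[k] H ⊗[k] H).toLinearMap ∘ₗ d.ofConv) := by
      have hc : toConv (comul (R := k) ∘ₗ d.ofConv) = toConv comul * toConv (comul ∘ₗ S) - 1 := by
        rw [← Bialgebra.toLinearMap_comulAlgHom, hd, toConv_algHom_comp_sub_one,
          LinearMap.algHom_comp_convMul_distrib]
        simp only [toConv_ofConv, LinearMap.comp_id]
      rw [hc, toConv_comul_comp_eq_includeRight_mul_includeLeft hcomul,
        toConv_comul_eq_includeLeft_mul_includeRight, hd]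
      simp only [toConv_algHom_comp_sub_one, LinearMap.algHom_comp_convMul_distrib,
        toConv_ofConv, LinearMap.comp_id]
      simp only [sub_mul, mul_sub, mul_one, mul_assoc]
      abel
    have h := congrArg (TensorProduct.map I.mkQ I.mkQ) (LinearMap.congr_fun (congrArg ofConv key) x)
    refine h.trans ?_
    rw [ofConv_add, LinearMap.add_apply, map_add, (ℛ k x).convMul_apply]
    simp only [(ℛ k ((ℛ k x).left _)).convMul_apply]
    simp [hmem, Finset.sum_mul]

end Antipode

section Universal

variable {k : Type} [Field k] {N : Type} [Ring N] [Bialgebra k N]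
  {A : Type} [CommRing A] [Algebra k A]
  {M : Type} [AddCommGroup M] [Module k M] [Coalgebra k M] {θ : M ⊗[k] N →ₗ[k] A}

lemma IsUniversalMeasuring.hom_ext (hM : IsUniversalMeasuring M θ) {C : Type} [AddCommGroup C]
    [Module k C] [Coalgebra k C] {φ ψ : C →ₗc[k] M}
    (h : ∀ c n, θ (φ c ⊗ₜ[k] n) = θ (ψ c ⊗ₜ[k] n)) : φ = ψ := by
  refine (hM.univ C _ (hM.meas.comp φ)).unique rfl ?_
  ext c n
  simpa using h c n

/-- A coideal of a universal measuring coalgebra which is killed by the measuring vanishes. -/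
lemma IsUniversalMeasuring.eq_bot_of_isCoideal (hM : IsUniversalMeasuring M θ)
    (D : Submodule k M) [D.IsCoideal] (hD : ∀ x ∈ D, ∀ n : N, θ (x ⊗ₜ[k] n) = 0) : D = ⊥ := by
  let θ' : (M ⧸ D) ⊗[k] N →ₗ[k] A := TensorProduct.lift <| D.liftQ (TensorProduct.curry θ)
    fun x hx => LinearMap.ext fun n => hD x hx n
  have hθ' (x : M) (n : N) : θ' (D.mkQ x ⊗ₜ[k] n) = θ (x ⊗ₜ[k] n) := rfl
  have hmeas : Measures θ' := by
    refine measures_iff.2 ⟨fun n n' => ?_, fun c => ?_⟩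
    · ext c
      exact (hM.meas.apply_mul (ℛ k c) n n').trans (conv_apply_repr
        ((ℛ k c).induced (Coalgebra.Quotient.mkQCoalgHom D)) (evalRight θ' n)
        (evalRight θ' n')).symm
    · obtain ⟨c, rfl⟩ := D.mkQ_surjective c
      rw [hθ', hM.meas.2]
      exact congrArg _
        (CoalgHomClass.counit_comp_apply (Coalgebra.Quotient.mkQCoalgHom (R := k) D) c).symm
  obtain ⟨φ, hφ, -⟩ := hM.univ _ θ' hmeas
  have hid : φ.comp (Coalgebra.Quotient.mkQCoalgHom D) = CoalgHom.id k M :=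
    hM.hom_ext fun c n => (LinearMap.congr_fun hφ (D.mkQ c ⊗ₜ[k] n)).symm
  refine (Submodule.eq_bot_iff _).2 fun x hx => ?_
  have h : φ (D.mkQ x) = x := DFunLike.congr_fun hid x
  have h0 : D.mkQ x = 0 := (Submodule.Quotient.mk_eq_zero D).2 hx
  rw [← h, h0, map_zero]

lemma IsUniversalMeasuring.existsUnique_mul (hM : IsUniversalMeasuring M θ) :
    ∃! m : M ⊗[k] M →ₗc[k] M, θ ∘ₗ LinearMap.rTensor N m.toLinearMap = mulMeasuring θ := by
  simpa only [eq_comm] using hM.univ _ _ hM.meas.mulMeasuring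

lemma IsUniversalMeasuring.existsUnique_one (hM : IsUniversalMeasuring M θ) :
    ∃! η : k →ₗc[k] M, ∀ n : N, θ (η 1 ⊗ₜ[k] n) = algebraMap k A (counit n) := by
  refine (existsUnique_congr fun η => ?_).1 (hM.univ k _ measures_counit)
  refine ⟨fun h n => ?_, fun h => ?_⟩
  · simpa [dropL] using (LinearMap.congr_fun h (1 ⊗ₜ[k] n)).symm
  · ext n
    simpa [dropL] using (h n).symm

variable {m : M ⊗[k] M →ₗc[k] M} {η : k →ₗc[k] M}

lemma measuring_mul_repr {ι : Type*}
    (hm : θ ∘ₗ LinearMap.rTensor N m.toLinearMap = mulMeasuring θ) (x y : M) {n : N}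
    (r : Repr k n ι) :
    θ (m (x ⊗ₜ[k] y) ⊗ₜ[k] n)
      = ∑ i ∈ r.index, θ (x ⊗ₜ[k] r.left i) * θ (y ⊗ₜ[k] r.right i) :=
  (LinearMap.congr_fun hm ((x ⊗ₜ[k] y) ⊗ₜ[k] n)).trans (mulMeasuring_repr θ x y r)

lemma IsUniversalMeasuring.mul_assoc (hM : IsUniversalMeasuring M θ)
    (hm : θ ∘ₗ LinearMap.rTensor N m.toLinearMap = mulMeasuring θ) (x y z : M) :
    m (m (x ⊗ₜ[k] y) ⊗ₜ[k] z) = m (x ⊗ₜ[k] m (y ⊗ₜ[k] z)) := by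
  have h : m.comp (Coalgebra.TensorProduct.map m (CoalgHom.id k M))
      = (m.comp (Coalgebra.TensorProduct.map (CoalgHom.id k M) m)).comp
        (Coalgebra.TensorProduct.assoc k k M M M : (M ⊗[k] M) ⊗[k] M →ₗc[k] M ⊗[k] (M ⊗[k] M)) := by
    refine hM.hom_ext fun c n => ?_
    induction c with
    | zero => simp
    | add c d hc hd => simp only [map_add, add_tmul, hc, hd]
    | tmul c z =>
      induction c with
      | zero => simp
      | add c d hc hd => simp only [map_add, add_tmul, hc, hd]
      | tmul x y =>
        change θ (m (m (x ⊗ₜ[k] y) ⊗ₜ[k] z) ⊗ₜ[k] n) = θ (m (x ⊗ₜ[k] m (y ⊗ₜ[k] z)) ⊗ₜ[k] n)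
        have h := congrArg (LinearMap.mul' k A ∘ₗ TensorProduct.map (θ ∘ₗ TensorProduct.mk k M N x)
          (LinearMap.mul' k A ∘ₗ TensorProduct.map (θ ∘ₗ TensorProduct.mk k M N y)
            (θ ∘ₗ TensorProduct.mk k M N z)))
          (sum_tmul_tmul_eq (ℛ k n) (fun i => ℛ k _) (fun i => ℛ k _))
        simp only [map_sum, LinearMap.comp_apply, map_tmul, mk_apply, LinearMap.mul'_apply] at h
        simp only [measuring_mul_repr hm _ _ (ℛ k _), Finset.mul_sum, Finset.sum_mul]
        simpa only [_root_.mul_assoc] using h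
  exact DFunLike.congr_fun h ((x ⊗ₜ[k] y) ⊗ₜ[k] z)

lemma IsUniversalMeasuring.one_mul (hM : IsUniversalMeasuring M θ)
    (hm : θ ∘ₗ LinearMap.rTensor N m.toLinearMap = mulMeasuring θ)
    (hη : ∀ n : N, θ (η 1 ⊗ₜ[k] n) = algebraMap k A (counit n)) (x : M) :
    m (η 1 ⊗ₜ[k] x) = x := by
  have h : (m.comp (Coalgebra.TensorProduct.map η (CoalgHom.id k M))).comp
      ((Coalgebra.TensorProduct.lid k M).symm : M →ₗc[k] k ⊗[k] M) = CoalgHom.id k M := by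
    refine hM.hom_ext fun x n => ?_
    change θ (m (η 1 ⊗ₜ[k] x) ⊗ₜ[k] n) = θ (x ⊗ₜ[k] n)
    have h := congrArg (θ ∘ₗ TensorProduct.mk k M N x) (sum_counit_smul (ℛ k n))
    simp only [map_sum, map_smul, LinearMap.comp_apply, mk_apply] at h
    simpa only [measuring_mul_repr hm _ _ (ℛ k n), hη, Algebra.smul_def] using h
  exact DFunLike.congr_fun h x

lemma IsUniversalMeasuring.mul_one (hM : IsUniversalMeasuring M θ)
    (hm : θ ∘ₗ LinearMap.rTensor N m.toLinearMap = mulMeasuring θ)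
    (hη : ∀ n : N, θ (η 1 ⊗ₜ[k] n) = algebraMap k A (counit n)) (x : M) :
    m (x ⊗ₜ[k] η 1) = x := by
  have h : (m.comp (Coalgebra.TensorProduct.map (CoalgHom.id k M) η)).comp
      ((Coalgebra.TensorProduct.rid k k M).symm : M →ₗc[k] M ⊗[k] k) = CoalgHom.id k M := by
    refine hM.hom_ext fun x n => ?_
    change θ (m (x ⊗ₜ[k] η 1) ⊗ₜ[k] n) = θ (x ⊗ₜ[k] n)
    have h := congrArg (θ ∘ₗ TensorProduct.mk k M N x ∘ₗ (TensorProduct.rid k N).toLinearMap)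
      (sum_tmul_counit_eq (ℛ k n))
    simp only [map_sum, map_smul, LinearMap.comp_apply, mk_apply, LinearEquiv.coe_coe,
      rid_tmul, one_smul] at h
    simpa only [measuring_mul_repr hm _ _ (ℛ k n), hη, mul_comm, Algebra.smul_def] using h
  exact DFunLike.congr_fun h x

/-- The multiplication of a universal measuring coalgebra makes it a ring. -/
@[reducible]
noncomputable def IsUniversalMeasuring.ring (hM : IsUniversalMeasuring M θ)
    (hm : θ ∘ₗ LinearMap.rTensor N m.toLinearMap = mulMeasuring θ)
    (hη : ∀ n : N, θ (η 1 ⊗ₜ[k] n) = algebraMap k A (counit n)) : Ring M :=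
  have h₁ (x y z : M) : m (x ⊗ₜ[k] (y + z)) = m (x ⊗ₜ[k] y) + m (x ⊗ₜ[k] z) := by
    rw [tmul_add, map_add]
  have h₂ (x y z : M) : m ((x + y) ⊗ₜ[k] z) = m (x ⊗ₜ[k] z) + m (y ⊗ₜ[k] z) := by
    rw [add_tmul, map_add]
  have h₃ (x : M) : m (x ⊗ₜ[k] 0) = 0 := by rw [tmul_zero, map_zero]
  have h₄ (x : M) : m (0 ⊗ₜ[k] x) = 0 := by rw [zero_tmul, map_zero]
  { ‹AddCommGroup M› with
    mul := fun x y => m (x ⊗ₜ[k] y)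
    one := η 1
    mul_assoc := hM.mul_assoc hm
    one_mul := hM.one_mul hm hη
    mul_one := hM.mul_one hm hη
    zero_mul := h₄
    mul_zero := h₃
    left_distrib := h₁
    right_distrib := h₂ }

/-- The `k`-algebra structure on a universal measuring coalgebra. -/
@[reducible]
noncomputable def IsUniversalMeasuring.algebra (hM : IsUniversalMeasuring M θ)
    (hm : θ ∘ₗ LinearMap.rTensor N m.toLinearMap = mulMeasuring θ)
    (hη : ∀ n : N, θ (η 1 ⊗ₜ[k] n) = algebraMap k A (counit n)) :
    @Algebra k M _ (hM.ring hm hη).toSemiring :=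
  letI := hM.ring hm hη
  have h₁ (r : k) (x y : M) : m ((r • x) ⊗ₜ[k] y) = r • m (x ⊗ₜ[k] y) := by
    rw [← smul_tmul', map_smul]
  have h₂ (r : k) (x y : M) : m (x ⊗ₜ[k] (r • y)) = r • m (x ⊗ₜ[k] y) := by
    rw [tmul_smul, map_smul]
  Algebra.ofModule h₁ h₂

/-- The bialgebra structure on a universal measuring coalgebra. -/
@[reducible]
noncomputable def IsUniversalMeasuring.bialgebra (hM : IsUniversalMeasuring M θ)
    (hm : θ ∘ₗ LinearMap.rTensor N m.toLinearMap = mulMeasuring θ)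
    (hη : ∀ n : N, θ (η 1 ⊗ₜ[k] n) = algebraMap k A (counit n)) :
    @Bialgebra k M _ (hM.ring hm hη).toSemiring :=
  have h₁ : counit (R := k) (η 1) = 1 := by simp
  have h₂ : comul (R := k) (η 1) = η 1 ⊗ₜ[k] η 1 := by
    rw [← CoalgHomClass.map_comp_comul_apply, CommSemiring.comul_apply]; rfl
  have h₃ (x y : M) : counit (R := k) (m (x ⊗ₜ[k] y))
      = counit (R := k) x * counit (R := k) y := by
    simp [mul_comm]
  have h₄ (x y : M) : comul (R := k) (m (x ⊗ₜ[k] y))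
      = TensorProduct.map m.toLinearMap m.toLinearMap
        (TensorProduct.tensorTensorTensorComm k M M M M (comul x ⊗ₜ[k] comul y)) := by
    rw [← CoalgHomClass.map_comp_comul_apply, TensorProduct.comul_tmul]; rfl
  letI := hM.ring hm hη
  letI := hM.algebra hm hη
  have h₅ (X Y : M ⊗[k] M) : TensorProduct.map m.toLinearMap m.toLinearMap
        (TensorProduct.tensorTensorTensorComm k M M M M (X ⊗ₜ[k] Y)) = X * Y := by
    induction X with
    | zero => simp only [zero_tmul, map_zero, zero_mul]
    | add X X' hX hX' => simp only [add_tmul, map_add, hX, hX', add_mul]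
    | tmul a b =>
      induction Y with
      | zero => simp only [tmul_zero, map_zero, mul_zero]
      | add Y Y' hY hY' => simp only [tmul_add, map_add, hY, hY', mul_add]
      | tmul c d => exact (Algebra.TensorProduct.tmul_mul_tmul a c b d).symm
  Bialgebra.mk' k M h₁ (h₃ _ _) h₂ ((h₄ _ _).trans (h₅ _ _))

end Universal

section Antipode

open WithConv

variable {k : Type} [Field k] {N : Type} [Ring N] [HopfAlgebra k N]
  {A : Type} [CommRing A] [Algebra k A]
  {M : Type} [Ring M] [Bialgebra k M] {θ : M ⊗[k] N →ₗ[k] A}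

lemma IsUniversalMeasuring.antipode_mul_id (hM : IsUniversalMeasuring M θ)
    (hmul : ∀ (x y : M) (n : N), θ ((x * y) ⊗ₜ[k] n) = mulMeasuring θ ((x ⊗ₜ[k] y) ⊗ₜ[k] n))
    (hone : ∀ n : N, θ (1 ⊗ₜ[k] n) = algebraMap k A (counit n)) {S : M →ₗ[k] M}
    (hcomul : comul ∘ₗ S = TensorProduct.map S S ∘ₗ (TensorProduct.comm k M M).toLinearMap
      ∘ₗ comul) (hcounit : counit ∘ₗ S = counit (R := k))
    (hS : ∀ (x : M) (n : N), θ (S x ⊗ₜ[k] n) = θ (x ⊗ₜ[k] HopfAlgebra.antipode k n)) :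
    toConv S * toConv LinearMap.id = 1 := by
  have := isCoideal_range_mul_id_sub_one hcomul hcounit
  have h := hM.eq_bot_of_isCoideal
    (LinearMap.range (toConv S * toConv LinearMap.id - 1).ofConv) ?_
  · rw [LinearMap.range_eq_bot] at h
    exact sub_eq_zero.1 (ofConv_injective h)
  rintro _ ⟨x, rfl⟩ n
  rw [ofConv_sub, LinearMap.sub_apply, sub_tmul, map_sub, sub_eq_zero, (ℛ k x).convMul_apply,
    LinearMap.convOne_apply, Algebra.algebraMap_eq_smul_one, ← smul_tmul', map_smul, hone,
    sum_tmul, map_sum]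
  simp only [LinearMap.id_apply, hmul, mulMeasuring_repr θ _ _ (ℛ k n), hS]
  rw [Finset.sum_comm]
  simp only [← hM.meas.apply_mul (ℛ k x)]
  rw [← map_sum, ← tmul_sum, HopfAlgebra.sum_antipode_mul_eq_algebraMap_counit,
    Algebra.algebraMap_eq_smul_one, tmul_smul, map_smul, hM.meas.2, Algebra.smul_def,
    Algebra.smul_def, mul_comm]

lemma IsUniversalMeasuring.id_mul_antipode (hM : IsUniversalMeasuring M θ)
    (hmul : ∀ (x y : M) (n : N), θ ((x * y) ⊗ₜ[k] n) = mulMeasuring θ ((x ⊗ₜ[k] y) ⊗ₜ[k] n))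
    (hone : ∀ n : N, θ (1 ⊗ₜ[k] n) = algebraMap k A (counit n)) {S : M →ₗ[k] M}
    (hcomul : comul ∘ₗ S = TensorProduct.map S S ∘ₗ (TensorProduct.comm k M M).toLinearMap
      ∘ₗ comul) (hcounit : counit ∘ₗ S = counit (R := k))
    (hS : ∀ (x : M) (n : N), θ (S x ⊗ₜ[k] n) = θ (x ⊗ₜ[k] HopfAlgebra.antipode k n)) :
    toConv LinearMap.id * toConv S = 1 := by
  have := isCoideal_range_id_mul_sub_one hcomul hcounit
  have h := hM.eq_bot_of_isCoideal
    (LinearMap.range (toConv LinearMap.id * toConv S - 1).ofConv) ?_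
  · rw [LinearMap.range_eq_bot] at h
    exact sub_eq_zero.1 (ofConv_injective h)
  rintro _ ⟨x, rfl⟩ n
  rw [ofConv_sub, LinearMap.sub_apply, sub_tmul, map_sub, sub_eq_zero, (ℛ k x).convMul_apply,
    LinearMap.convOne_apply, Algebra.algebraMap_eq_smul_one, ← smul_tmul', map_smul, hone,
    sum_tmul, map_sum]
  simp only [LinearMap.id_apply, hmul, mulMeasuring_repr θ _ _ (ℛ k n), hS]
  rw [Finset.sum_comm]
  simp only [← hM.meas.apply_mul (ℛ k x)]
  rw [← map_sum, ← tmul_sum, HopfAlgebra.sum_mul_antipode_eq_algebraMap_counit,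
    Algebra.algebraMap_eq_smul_one, tmul_smul, map_smul, hM.meas.2, Algebra.smul_def,
    Algebra.smul_def, mul_comm]

end Antipode

section HopfUniversal

variable {k : Type} [Field k] {N : Type} [Ring N] [HopfAlgebra k N]
  {A : Type} [CommRing A] [Algebra k A]
  {M : Type} [AddCommGroup M] [Module k M] [Coalgebra k M] {θ : M ⊗[k] N →ₗ[k] A}

lemma IsUniversalMeasuring.existsUnique_antipode (hM : IsUniversalMeasuring M θ) :
    ∃! S : M →ₗ[k] M,
      (comul (R := k) (A := M) ∘ₗ S
          = TensorProduct.map S S ∘ₗ (TensorProduct.comm k M M).toLinearMap ∘ₗ comul)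
        ∧ counit (R := k) (A := M) ∘ₗ S = counit
        ∧ θ ∘ₗ LinearMap.rTensor N S
            = θ ∘ₗ LinearMap.lTensor M (HopfAlgebra.antipode (R := k)) := by
  obtain ⟨φ, hφ, huniq⟩ := hM.univ (Coop M) _ hM.meas.comp_antipode
  refine ⟨φ.toLinearMap ∘ₗ (Coop.equiv k M).toLinearMap, ⟨?_, ?_, ?_⟩, ?_⟩
  · ext x
    have h := CoalgHomClass.map_comp_comul_apply φ (Coop.equiv k M x)
    rw [Coop.comul_equiv] at h
    refine h.symm.trans ?_
    simp [← (ℛ k x).eq]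
  · ext x
    exact CoalgHomClass.counit_comp_apply φ (Coop.equiv k M x)
  · ext x n
    simpa using (LinearMap.congr_fun hφ (Coop.equiv k M x ⊗ₜ[k] n)).symm
  · rintro S ⟨hcomul, hcounit, hS⟩
    let ψ : Coop M →ₗc[k] M :=
      { S ∘ₗ (Coop.equiv k M).symm.toLinearMap with
        counit_comp := by
          ext x'
          obtain ⟨x, rfl⟩ := (Coop.equiv k M).surjective x'
          exact LinearMap.congr_fun hcounit x
        map_comp_comul := by
          ext x'
          obtain ⟨x, rfl⟩ := (Coop.equiv k M).surjective x'
          have h := LinearMap.congr_fun hcomul x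
          simp only [LinearMap.comp_apply, LinearEquiv.coe_coe, ← (ℛ k x).eq, map_sum, comm_tmul,
            map_tmul] at h
          simp only [LinearMap.comp_apply, ← (Coop.repr (ℛ k x)).eq, map_sum, map_tmul]
          exact h.symm }
    have h : ψ = φ := huniq ψ <| by
      ext x n
      exact (LinearMap.congr_fun hS ((Coop.equiv k M).symm x ⊗ₜ[k] n)).symm
    rw [← h]
    rfl

end HopfUniversal

/-- **Proposition (the universal measuring coalgebra `M(N,A)` is a Hopf algebra).**
Let `N` be a Hopf algebra over `k`, `A` a commutative `k`-algebra, and `(M, θ)` a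
universal measuring coalgebra of `N` to `A`.  Then there are unique coalgebra maps
`m : M ⊗ M → M` and `η : k → M` with `θ(m(f⊗g) ⊗ n) = ∑ θ(f⊗n₍₁₎) θ(g⊗n₍₂₎)` and
`θ(η(1) ⊗ n) = ε(n)1`; with this multiplication and unit `M` is an associative unital
algebra — indeed a bialgebra — and the unique coalgebra map `S : M^cop → M` with
`θ(S(f) ⊗ n) = θ(f ⊗ S_N(n))` is an antipode, so `M` is a Hopf algebra. -/
theorem universal_measuring_hopf_structure
    {k : Type} [Field k] {N A : Type} [Ring N] [HopfAlgebra k N]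
    [CommRing A] [Algebra k A]
    {M : Type} [AddCommGroup M] [Module k M] [Coalgebra k M]
    (θ : M ⊗[k] N →ₗ[k] A) (hM : IsUniversalMeasuring M θ) :
    -- unique multiplication
    (∃! m : M ⊗[k] M →ₗc[k] M,
      θ ∘ₗ LinearMap.rTensor N m.toLinearMap = mulMeasuring θ)
    -- unique unit
    ∧ (∃! η : k →ₗc[k] M,
        ∀ n : N, θ (η 1 ⊗ₜ[k] n) = algebraMap k A (Coalgebra.counit n))
    -- the resulting structure is a Hopf algebra
    ∧ (∀ (m : M ⊗[k] M →ₗc[k] M) (η : k →ₗc[k] M),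
        θ ∘ₗ LinearMap.rTensor N m.toLinearMap = mulMeasuring θ →
        (∀ n : N, θ (η 1 ⊗ₜ[k] n) = algebraMap k A (Coalgebra.counit n)) →
        -- associativity
        (m.toLinearMap ∘ₗ LinearMap.rTensor M m.toLinearMap
          = m.toLinearMap ∘ₗ LinearMap.lTensor M m.toLinearMap
              ∘ₗ (TensorProduct.assoc k M M M).toLinearMap)
        -- unit laws
        ∧ (∀ x : M, m (η 1 ⊗ₜ[k] x) = x ∧ m (x ⊗ₜ[k] η 1) = x)
        -- the unique antipode: a coalgebra map `M^cop → M` with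
        -- `θ(S(f) ⊗ n) = θ(f ⊗ S_N(n))`
        ∧ (∃! S : M →ₗ[k] M,
            ((Coalgebra.comul (R := k) (A := M)) ∘ₗ S
                = TensorProduct.map S S ∘ₗ (TensorProduct.comm k M M).toLinearMap
                    ∘ₗ Coalgebra.comul)
              ∧ (Coalgebra.counit (R := k) (A := M)) ∘ₗ S = Coalgebra.counit
              ∧ θ ∘ₗ LinearMap.rTensor N S
                  = θ ∘ₗ LinearMap.lTensor M (HopfAlgebra.antipode (R := k)))
        -- ... and it satisfies the antipode axioms
        ∧ (∀ S : M →ₗ[k] M,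
            ((Coalgebra.comul (R := k) (A := M)) ∘ₗ S
                = TensorProduct.map S S ∘ₗ (TensorProduct.comm k M M).toLinearMap
                    ∘ₗ Coalgebra.comul) →
            (Coalgebra.counit (R := k) (A := M)) ∘ₗ S = Coalgebra.counit →
            θ ∘ₗ LinearMap.rTensor N S
                = θ ∘ₗ LinearMap.lTensor M (HopfAlgebra.antipode (R := k)) →
            m.toLinearMap ∘ₗ LinearMap.rTensor M S ∘ₗ Coalgebra.comul
                = η.toLinearMap ∘ₗ Coalgebra.counit
              ∧ m.toLinearMap ∘ₗ LinearMap.lTensor M S ∘ₗ Coalgebra.comul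
                = η.toLinearMap ∘ₗ Coalgebra.counit)) := by
  refine ⟨hM.existsUnique_mul, hM.existsUnique_one, fun m η hm hη => ⟨?_, fun x =>
    ⟨hM.one_mul hm hη x, hM.mul_one hm hη x⟩, hM.existsUnique_antipode,
    fun S hcomul hcounit hS => ?_⟩⟩
  · ext x y z
    exact hM.mul_assoc hm x y z
  · let := hM.ring hm hη
    let := hM.bialgebra hm hη
    have hmul (x y : M) (n : N) : θ ((x * y) ⊗ₜ[k] n) = mulMeasuring θ ((x ⊗ₜ[k] y) ⊗ₜ[k] n) :=
      LinearMap.congr_fun hm ((x ⊗ₜ[k] y) ⊗ₜ[k] n)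
    have hS' (x : M) (n : N) : θ (S x ⊗ₜ[k] n) = θ (x ⊗ₜ[k] HopfAlgebra.antipode k n) :=
      LinearMap.congr_fun hS (x ⊗ₜ[k] n)
    have h₁ := hM.antipode_mul_id hmul hη hcomul hcounit hS'
    have h₂ := hM.id_mul_antipode hmul hη hcomul hcounit hS'
    have hone (x : M) : η (counit x) = algebraMap k M (counit x) := by
      rw [Algebra.algebraMap_eq_smul_one]
      refine .trans ?_ (map_smul η (counit x) 1)
      rw [smul_eq_mul, mul_one]
    constructor
    · ext x
      refine .trans ?_ ((LinearMap.congr_fun (congrArg WithConv.ofConv h₁) x).trans (hone x).symm)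
      rw [(ℛ k x).convMul_apply]
      simp only [LinearMap.comp_apply, ← (ℛ k x).eq, map_sum, LinearMap.rTensor_tmul]
      rfl
    · ext x
      refine .trans ?_ ((LinearMap.congr_fun (congrArg WithConv.ofConv h₂) x).trans (hone x).symm)
      rw [(ℛ k x).convMul_apply]
      simp only [LinearMap.comp_apply, ← (ℛ k x).eq, map_sum, LinearMap.lTensor_tmul]
      rfl
end

section
/- Let N be a cocommutative Hopf algebra over a field k, A a commutative k-algebra, and (M,θ) a universal measuring coalgebra of N to A, equipped with the unique multiplication m: M⊗M → M that is a coalgebra map satisfying θ(m(f⊗g)⊗n) = ∑ θ(f⊗n_(1)) θ(g⊗n_(2)). Then m is commutative. -/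
open TensorProduct

open TensorProduct SmashPaper


namespace SmashPaper

theorem conv_comp_coalgHom {k C D A : Type} [Field k] [AddCommGroup C] [Module k C]
    [Coalgebra k C] [AddCommGroup D] [Module k D] [Coalgebra k D] [CommRing A] [Algebra k A]
    (f g : D →ₗ[k] A) (ψ : C →ₗc[k] D) :
    conv (f ∘ₗ ψ.toLinearMap) (g ∘ₗ ψ.toLinearMap) = conv f g ∘ₗ ψ.toLinearMap := by
  simp only [conv, LinearMap.comp_assoc]
  rw [← ψ.map_comp_comul, TensorProduct.map_comp, LinearMap.comp_assoc]

theorem Measures.comp_rTensor {k C D N A : Type} [Field k] [AddCommGroup C] [Module k C]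
    [Coalgebra k C] [AddCommGroup D] [Module k D] [Coalgebra k D] [Ring N] [Bialgebra k N]
    [CommRing A] [Algebra k A] {θ : D ⊗[k] N →ₗ[k] A} (h : Measures θ) (φ : C →ₗc[k] D) :
    Measures (θ ∘ₗ LinearMap.rTensor N φ.toLinearMap) := by
  refine ⟨?_, fun c => ?_⟩
  · have hcomm {P : Type} [AddCommGroup P] [Module k P] (u : P →ₗ[k] N) :
        (θ ∘ₗ LinearMap.rTensor N φ.toLinearMap) ∘ₗ LinearMap.lTensor C u =
          (θ ∘ₗ LinearMap.lTensor D u) ∘ₗ LinearMap.rTensor P φ.toLinearMap := by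
      ext; simp
    have hψ : LinearMap.rTensor (N ⊗[k] N) φ.toLinearMap =
        (Coalgebra.TensorProduct.map φ (CoalgHom.id k (N ⊗[k] N))).toLinearMap := by
      ext; simp
    rw [hcomm, hcomm, hcomm, hψ, conv_comp_coalgHom, h.1]
  · simpa using h.2 (φ c)

/-- The flip of the tensor factors, as a morphism of coalgebras. -/
noncomputable def commCoalgHom (k C : Type) [Field k] [AddCommGroup C] [Module k C]
    [Coalgebra k C] : C ⊗[k] C →ₗc[k] C ⊗[k] C where
  __ := (TensorProduct.comm k C C).toLinearMap
  counit_comp := by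
    ext x y
    simp [mul_comm]
  map_comp_comul := by
    ext x y
    have key (u v : C ⊗[k] C) :
        TensorProduct.map (TensorProduct.comm k C C).toLinearMap
            (TensorProduct.comm k C C).toLinearMap
            (TensorProduct.tensorTensorTensorComm k C C C C (u ⊗ₜ[k] v)) =
          TensorProduct.tensorTensorTensorComm k C C C C (v ⊗ₜ[k] u) := by
      induction u with
      | zero => simp
      | add _ _ h₁ h₂ => simp only [TensorProduct.add_tmul, TensorProduct.tmul_add, map_add, h₁, h₂]
      | tmul a b =>
        induction v with
        | zero => simp
        | add _ _ h₁ h₂ =>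
          simp only [TensorProduct.add_tmul, TensorProduct.tmul_add, map_add, h₁, h₂]
        | tmul c d => simp
    simpa [TensorProduct.comul_def, TensorProduct.AlgebraTensorModule.tensorTensorTensorComm_eq]
      using key (Coalgebra.comul x) (Coalgebra.comul y)

theorem mulMeasuring_comp_comm {k N A M : Type} [Field k] [Ring N] [Bialgebra k N] [CommRing A]
    [Algebra k A] [AddCommGroup M] [Module k M] (hN : IsCocomm k N)
    (θ : M ⊗[k] N →ₗ[k] A) :
    mulMeasuring θ ∘ₗ LinearMap.rTensor N (TensorProduct.comm k M M).toLinearMap =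
      mulMeasuring θ := by
  ext f g n
  have key (u : N ⊗[k] N) :
      LinearMap.mul' k A (TensorProduct.map θ θ
          (TensorProduct.tensorTensorTensorComm k M M N N ((g ⊗ₜ[k] f) ⊗ₜ[k] u))) =
        LinearMap.mul' k A (TensorProduct.map θ θ
          (TensorProduct.tensorTensorTensorComm k M M N N
            ((f ⊗ₜ[k] g) ⊗ₜ[k] TensorProduct.comm k N N u))) := by
    induction u with
    | zero => simp
    | add _ _ h₁ h₂ => simp only [TensorProduct.tmul_add, map_add, h₁, h₂]
    | tmul a b => simp [mul_comm]
  have hn : TensorProduct.comm k N N (Coalgebra.comul n) = Coalgebra.comul n :=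
    LinearMap.congr_fun hN n
  simpa [mulMeasuring, hn] using key (Coalgebra.comul n)

end SmashPaper

/-- **Proposition (if `N` is cocommutative then `M(N,A)` is commutative).**
Let `N` be a cocommutative Hopf algebra over `k`, `A` a commutative `k`-algebra, and
`(M, θ)` a universal measuring coalgebra of `N` to `A`, equipped with the unique
multiplication `m` that is a coalgebra map satisfying
`θ(m(f⊗g) ⊗ n) = ∑ θ(f⊗n₍₁₎) θ(g⊗n₍₂₎)`.  Then `m` is commutative. -/
theorem universal_measuring_commutative
    {k : Type} [Field k] {N A : Type} [Ring N] [HopfAlgebra k N]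
    [CommRing A] [Algebra k A]
    (hNcc : IsCocomm k N)
    {M : Type} [AddCommGroup M] [Module k M] [Coalgebra k M]
    (θ : M ⊗[k] N →ₗ[k] A) (hM : IsUniversalMeasuring M θ)
    (m : M ⊗[k] M →ₗc[k] M)
    (hm : θ ∘ₗ LinearMap.rTensor N m.toLinearMap = mulMeasuring θ) :
    m.toLinearMap ∘ₗ (TensorProduct.comm k M M).toLinearMap = m.toLinearMap := by
  have hc : ((m.comp (commCoalgHom k M)).toLinearMap) =
      m.toLinearMap ∘ₗ (TensorProduct.comm k M M).toLinearMap := rfl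
  have h := (hM.univ (M ⊗[k] M) _ (hM.meas.comp_rTensor m)).unique
    (y₁ := m.comp (commCoalgHom k M)) (y₂ := m) ?_ rfl
  · rw [← hc, h]
  · rw [hc, LinearMap.rTensor_comp, ← LinearMap.comp_assoc, hm, mulMeasuring_comp_comm hNcc]
end
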